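/- arXiv:2304.06012 — 2 statements merged into one kernel-verified Lean document; each statement's English description precedes it below -/
import Mathlib

section
/- Let K be the attractor of a countable (finite or infinite) iterated function system F of contractions on a compact metric space, satisfying K = ⋃_{φ∈F} φ(K), with K a nonempty compact connected set. If sdim(F) = 1 (i.e., ∑_{φ∈F} Lip(φ)^1 ≤ 1), then K is isometric to a closed line segment (possibly degenerate). -/
open scoped ENNReal NNReal

open MeasureTheory Measure Set Filter Topology

/-- A level of a continuous function which meets a preconnected closed set in at most one point
cuts that set into preconnected pieces. -/
theorem IsPreconnected.inter_setOf_le_of_subsingleton_fiber {X : Type*} [TopologicalSpace X]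
    {K : Set X} (hK : IsPreconnected K) (hKc : IsClosed K) {f : X → ℝ} (hf : Continuous f)
    {u : ℝ} (hu : (K ∩ f ⁻¹' {u}).Subsingleton) : IsPreconnected (K ∩ {p | f p ≤ u}) := by
  classical
  by_cases hle : K ⊆ {p | f p ≤ u}
  · rwa [inter_eq_left.2 hle]
  rcases (K ∩ {p | f p ≤ u}).eq_empty_or_nonempty with hem | ⟨a, haK, hau⟩
  · rw [hem]
    exact isPreconnected_empty
  obtain ⟨b, hbK, hbu⟩ := not_subset.1 hle
  obtain ⟨z, hzK, hz⟩ := hK.intermediate_value haK hbK hf.continuousOn ⟨hau, (not_le.1 hbu).le⟩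
  set r : X → X := fun p => if f p ≤ u then p else z with hr
  have hsplit : K = (K ∩ {p | f p ≤ u}) ∪ (K ∩ {p | u ≤ f p}) := by
    ext p
    have := le_total (f p) u
    simp only [mem_union, mem_inter_iff, mem_ofPred_eq]
    tauto
  have hcont : ContinuousOn r K := by
    rw [hsplit]
    refine ContinuousOn.union_of_isClosed ?_ ?_ (hKc.inter (isClosed_le hf continuous_const))
      (hKc.inter (isClosed_le continuous_const hf))
    · exact continuousOn_id.congr fun p hp => if_pos hp.2
    · refine (continuousOn_const (c := z)).congr fun p hp => ?_
      by_cases h : f p ≤ u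
      · simp only [hr, if_pos h]
        exact hu ⟨hp.1, le_antisymm h hp.2⟩ ⟨hzK, hz⟩
      · exact if_neg h
  have himage : r '' K = K ∩ {p | f p ≤ u} := by
    ext p
    constructor
    · rintro ⟨q, hq, rfl⟩
      by_cases h : f q ≤ u
      · simpa only [hr, if_pos h] using ⟨hq, h⟩
      · simpa only [hr, if_neg h] using ⟨hzK, hz.le⟩
    · rintro ⟨hp, hpu⟩
      exact ⟨p, hp, if_pos hpu⟩
  rw [← himage]
  exact hK.image r hcont

/-- A `1`-Lipschitz real function does not increase length. -/
theorem volume_image_le_hausdorffMeasure {X : Type*} [MetricSpace X] [MeasurableSpace X]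
    [BorelSpace X] {f : X → ℝ} (hf : LipschitzWith 1 f) (S : Set X) :
    volume (f '' S) ≤ μH[1] S := by
  rw [← hausdorffMeasure_real]
  simpa using hf.hausdorffMeasure_image_le zero_le_one S

/-- The distance of two points of a connected set is at most the length of that set. -/
theorem IsPreconnected.edist_le_hausdorffMeasure {X : Type*} [MetricSpace X] [MeasurableSpace X]
    [BorelSpace X] {C : Set X} (hC : IsPreconnected C) {p q : X} (hp : p ∈ C) (hq : q ∈ C) :
    edist p q ≤ μH[1] C := by
  refine le_trans ?_ (volume_image_le_hausdorffMeasure (LipschitzWith.dist_right p) C)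
  have h := hC.intermediate_value hp hq (f := dist p) (by fun_prop)
  rw [dist_self] at h
  calc edist p q = volume (Icc 0 (dist p q)) := by simp [edist_dist]
    _ ≤ _ := measure_mono h

section LengthAtMostImage

variable {X : Type*} [MetricSpace X] [MeasurableSpace X] [BorelSpace X] {K : Set X} {f : X → ℝ}

/-- If a `1`-Lipschitz function does not shrink the length of `K`, it does not shrink the length
of the part of `K` over a measurable set. -/
theorem hausdorffMeasure_inter_preimage_le (hf : LipschitzWith 1 f)
    (hfK : μH[1] K ≤ volume (f '' K)) (hfin : volume (f '' K) ≠ ∞) {B : Set ℝ}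
    (hB : MeasurableSet B) : μH[1] (K ∩ f ⁻¹' B) ≤ volume (f '' K ∩ B) := by
  have hdiff : volume (f '' K \ B) ≤ μH[1] (K \ f ⁻¹' B) := by
    refine le_trans (measure_mono ?_) (volume_image_le_hausdorffMeasure hf _)
    rintro _ ⟨⟨p, hp, rfl⟩, hpB⟩
    exact ⟨p, ⟨hp, hpB⟩, rfl⟩
  have hsum : μH[1] (K ∩ f ⁻¹' B) + μH[1] (K \ f ⁻¹' B)
      ≤ volume (f '' K ∩ B) + volume (f '' K \ B) := by
    rwa [measure_inter_add_sdiff _ (hf.continuous.measurable hB), measure_inter_add_sdiff _ hB]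
  exact (ENNReal.add_le_add_iff_right (measure_ne_top_of_subset sdiff_subset hfin)).1
    ((add_le_add le_rfl hdiff).trans hsum)

/-- If a `1`-Lipschitz function does not shrink the length of `K`, disjoint compact parts of `K`
have almost disjoint images. -/
theorem volume_image_inter_image_eq_zero (hf : LipschitzWith 1 f)
    (hfK : μH[1] K ≤ volume (f '' K)) (hfin : volume (f '' K) ≠ ∞) {S T : Set X}
    (hS : IsCompact S) (hT : IsCompact T) (hSK : S ⊆ K) (hTK : T ⊆ K) (hST : Disjoint S T) :
    volume (f '' S ∩ f '' T) = 0 := by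
  set P := f '' S ∩ f '' T with hP
  have hPm : MeasurableSet P :=
    (hS.image hf.continuous).measurableSet.inter (hT.image hf.continuous).measurableSet
  have hPK : P ⊆ f '' K := inter_subset_left.trans (image_mono hSK)
  have hPS : volume P ≤ μH[1] (S ∩ f ⁻¹' P) := by
    refine le_trans (measure_mono ?_) (volume_image_le_hausdorffMeasure hf _)
    rintro _ ⟨⟨p, hp, rfl⟩, h⟩
    exact ⟨p, ⟨hp, ⟨p, hp, rfl⟩, h⟩, rfl⟩
  have hPT : volume P ≤ μH[1] (T ∩ f ⁻¹' P) := by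
    refine le_trans (measure_mono ?_) (volume_image_le_hausdorffMeasure hf _)
    rintro _ ⟨h, ⟨p, hp, rfl⟩⟩
    exact ⟨p, ⟨hp, h, ⟨p, hp, rfl⟩⟩, rfl⟩
  have hunion : μH[1] (S ∩ f ⁻¹' P) + μH[1] (T ∩ f ⁻¹' P) ≤ volume P := by
    rw [← measure_union (hST.mono inter_subset_left inter_subset_left)
      (hT.measurableSet.inter (hf.continuous.measurable hPm)), ← union_inter_distrib_right]
    calc _ ≤ μH[1] (K ∩ f ⁻¹' P) :=
          measure_mono (inter_subset_inter_left _ (union_subset hSK hTK))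
      _ ≤ volume (f '' K ∩ P) := hausdorffMeasure_inter_preimage_le hf hfK hfin hPm
      _ ≤ volume P := measure_mono inter_subset_right
  have htwice : volume P + volume P ≤ 0 + volume P := by
    rw [zero_add]
    exact (add_le_add hPS hPT).trans hunion
  exact nonpos_iff_eq_zero.1
    ((ENNReal.add_le_add_iff_right (measure_ne_top_of_subset hPK hfin)).1 htwice)

/-- If a `1`-Lipschitz function does not shrink the length of a compact set, almost all of its
fibers have at most one point. -/
theorem ae_subsingleton_fiber [SecondCountableTopology X] (hK : IsCompact K)
    (hf : LipschitzWith 1 f) (hfK : μH[1] K ≤ volume (f '' K)) (hfin : volume (f '' K) ≠ ∞) :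
    ∀ᵐ u, (K ∩ f ⁻¹' {u}).Subsingleton := by
  rcases K.eq_empty_or_nonempty with rfl | ⟨x, -⟩
  · simp
  have : Nonempty X := ⟨x⟩
  set c := TopologicalSpace.denseSeq X
  set S : ℕ → ℚ → Set X := fun n r => K ∩ {p | dist p (c n) ≤ r} with hS
  set T : ℕ → ℚ → Set X := fun n r => K ∩ {p | (r : ℝ) ≤ dist p (c n)} with hT
  have hnull : ∀ n : ℕ, ∀ r s : ℚ, r < s → volume (f '' S n r ∩ f '' T n s) = 0 := by
    intro n r s hrs
    refine volume_image_inter_image_eq_zero hf hfK hfin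
      (hK.inter_right (isClosed_le (by fun_prop) (by fun_prop)))
      (hK.inter_right (isClosed_le (by fun_prop) (by fun_prop)))
      inter_subset_left inter_subset_left ?_
    rw [Set.disjoint_left]
    rintro p ⟨-, hp⟩ ⟨-, hp'⟩
    have : (r : ℝ) < s := by exact_mod_cast hrs
    simp only [mem_ofPred_eq] at hp hp'
    linarith
  have hae : ∀ᵐ u, ∀ n : ℕ, ∀ r s : ℚ, r < s → u ∉ f '' S n r ∩ f '' T n s := by
    simp only [ae_all_iff]
    exact fun n r s hrs => measure_eq_zero_iff_ae_notMem.1 (hnull n r s hrs)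
  filter_upwards [hae] with u hu p hp q hq
  by_contra hpq
  have hpos : 0 < dist p q := dist_pos.2 hpq
  obtain ⟨n, hn⟩ := (TopologicalSpace.denseRange_denseSeq X).exists_dist_lt p (half_pos hpos)
  have hlt : dist p (c n) < dist q (c n) := by
    have := dist_triangle_right p q (c n)
    change dist p (c n) < _ at hn
    linarith
  obtain ⟨r, hr, hr'⟩ := exists_rat_btwn hlt
  obtain ⟨s, hs, hs'⟩ := exists_rat_btwn hr'
  exact hu n r s (by exact_mod_cast hs)
    ⟨⟨p, ⟨hp.1, hr.le⟩, hp.2⟩, ⟨q, ⟨hq.1, hs'.le⟩, hq.2⟩⟩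

/-- A `1`-Lipschitz function that does not shrink the length of a continuum is isometric on it. -/
theorem dist_le_abs_sub_of_hausdorffMeasure_le [SecondCountableTopology X] (hK : IsCompact K)
    (hconn : IsPreconnected K) (hf : LipschitzWith 1 f) (hfK : μH[1] K ≤ volume (f '' K))
    {p q : X} (hp : p ∈ K) (hq : q ∈ K) : dist p q ≤ |f p - f q| := by
  wlog hpq : f p ≤ f q generalizing p q
  · rw [dist_comm, abs_sub_comm]
    exact this hq hp (le_of_not_ge hpq)
  rw [abs_sub_comm, abs_of_nonneg (sub_nonneg.2 hpq)]
  have hfin : volume (f '' K) ≠ ∞ := (hK.image hf.continuous).measure_lt_top.ne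
  have hdense := dense_of_ae (ae_subsingleton_fiber hK hf hfK hfin)
  refine le_of_forall_pos_le_add fun ε hε => ?_
  obtain ⟨s, hs, hs₁, hs₂⟩ := hdense.exists_between (show f p - ε / 2 < f p by linarith)
  obtain ⟨t, ht, ht₁, ht₂⟩ := hdense.exists_between (show f q < f q + ε / 2 by linarith)
  have hC₁ := hconn.inter_setOf_le_of_subsingleton_fiber hK.isClosed hf.continuous ht
  have hC₂ : IsPreconnected ((K ∩ {p | f p ≤ t}) ∩ {p | -f p ≤ -s}) := by
    refine hC₁.inter_setOf_le_of_subsingleton_fiber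
      (hK.isClosed.inter (isClosed_le hf.continuous continuous_const)) hf.continuous.neg ?_
    refine Set.Subsingleton.anti hs ?_
    rintro a ⟨⟨ha, -⟩, has⟩
    exact ⟨ha, neg_injective has⟩
  have hle := hC₂.edist_le_hausdorffMeasure (p := p) (q := q)
    ⟨⟨hp, show f p ≤ t by linarith⟩, show -f p ≤ -s by linarith⟩
    ⟨⟨hq, show f q ≤ t by linarith⟩, show -f q ≤ -s by linarith⟩
  have hsub : (K ∩ {p | f p ≤ t}) ∩ {p | -f p ≤ -s} ⊆ K ∩ f ⁻¹' Icc s t := by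
    rintro a ⟨⟨ha, hat⟩, has⟩
    exact ⟨ha, neg_le_neg_iff.1 has, hat⟩
  have hedist : edist p q ≤ ENNReal.ofReal (t - s) :=
    calc edist p q ≤ μH[1] (K ∩ f ⁻¹' Icc s t) := hle.trans (measure_mono hsub)
      _ ≤ volume (f '' K ∩ Icc s t) :=
          hausdorffMeasure_inter_preimage_le hf hfK hfin measurableSet_Icc
      _ ≤ volume (Icc s t) := measure_mono inter_subset_right
      _ = ENNReal.ofReal (t - s) := Real.volume_Icc
  rw [edist_dist, ENNReal.ofReal_le_ofReal_iff (by linarith)] at hedist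
  linarith

end LengthAtMostImage

/-- A continuum whose length is at most its diameter is isometric to a segment. -/
theorem exists_isometryEquiv_Icc_of_hausdorffMeasure_le {X : Type*} [MetricSpace X]
    [SecondCountableTopology X] [MeasurableSpace X] [BorelSpace X] {K : Set X} (hK : IsCompact K)
    (hconn : IsConnected K) (hlen : μH[1] K ≤ Metric.ediam K) :
    ∃ d : ℝ, 0 ≤ d ∧ Nonempty (↥K ≃ᵢ ↥(Icc (0 : ℝ) d)) := by
  obtain ⟨⟨x, y⟩, ⟨hx, hy⟩, hmax⟩ := (hK.prod hK).exists_isMaxOn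
    (hconn.nonempty.prod hconn.nonempty) (f := fun z : X × X => dist z.1 z.2)
    (by fun_prop)
  have hle : ∀ p ∈ K, ∀ q ∈ K, dist p q ≤ dist x y := fun p hp q hq => hmax (mk_mem_prod hp hq)
  have himage : dist x '' K = Icc 0 (dist x y) := by
    refine Subset.antisymm ?_ ?_
    · rintro _ ⟨p, hp, rfl⟩
      exact ⟨dist_nonneg, hle x hx p hp⟩
    · have h := hconn.isPreconnected.intermediate_value hx hy (f := dist x) (by fun_prop)
      rwa [dist_self] at h
  have hlen' : μH[1] K ≤ volume (dist x '' K) := by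
    rw [himage, Real.volume_Icc, sub_zero]
    refine hlen.trans (Metric.ediam_le fun p hp q hq => ?_)
    rw [edist_dist]
    exact ENNReal.ofReal_le_ofReal (hle p hp q hq)
  have hiso : ∀ p ∈ K, ∀ q ∈ K, dist (dist x p) (dist x q) = dist p q := fun p hp q hq =>
    le_antisymm (by simpa using (LipschitzWith.dist_right x).dist_le_mul p q)
      (dist_le_abs_sub_of_hausdorffMeasure_le hK hconn.isPreconnected (LipschitzWith.dist_right x)
        hlen' hp hq)
  let g : K → Icc (0 : ℝ) (dist x y) := fun p => ⟨dist x p, himage ▸ mem_image_of_mem _ p.2⟩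
  have hg : Isometry g := Isometry.of_dist_eq fun p q => hiso p p.2 q q.2
  have hsurj : Function.Surjective g := by
    rintro ⟨u, hu⟩
    rw [← himage] at hu
    obtain ⟨p, hp, rfl⟩ := hu
    exact ⟨⟨p, hp⟩, rfl⟩
  exact ⟨dist x y, dist_nonneg, ⟨⟨Equiv.ofBijective g ⟨hg.injective, hsurj⟩, hg⟩⟩⟩

/-- Nonnegative numbers below `1` with sum at most `1` are uniformly below `1`. -/
theorem exists_lt_one_forall_le_of_tsum_le_one {A : Type*} {L : A → ℝ≥0} (hL : ∀ i, L i < 1)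
    (hsum : ∑' i, (L i : ℝ≥0∞) ≤ 1) : ∃ c : ℝ≥0, c < 1 ∧ ∀ i, L i ≤ c := by
  have hsummable : Summable L :=
    ENNReal.tsum_coe_ne_top_iff_summable.1 (hsum.trans_lt ENNReal.one_lt_top).ne
  obtain ⟨θ, hθ, hθ'⟩ := exists_between (zero_lt_one : (0 : ℝ≥0) < 1)
  have hfinite : {i | ¬ L i < θ}.Finite :=
    eventually_cofinite.1
      ((NNReal.tendsto_cofinite_zero_of_summable hsummable).eventually_lt_const hθ)
  obtain ⟨m, hm, hLm⟩ : ∃ m : ℝ≥0, m < 1 ∧ ∀ i, ¬ L i < θ → L i ≤ m :=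
    ⟨hfinite.toFinset.sup L, (Finset.sup_lt_iff (by simp)).2 fun i _ => hL i,
      fun i hi => Finset.le_sup (hfinite.mem_toFinset.2 hi)⟩
  refine ⟨max θ m, max_lt hθ' hm, fun i => ?_⟩
  by_cases h : L i < θ
  · exact le_max_of_le_left h.le
  · exact le_max_of_le_right (hLm i h)

/-- A self-similar set with contraction ratios of sum at most `1` has arbitrarily fine covers
whose diameters add up to at most that of the set. -/
theorem exists_cover_of_subset_iUnion_image {X : Type*} [MetricSpace X] {A : Type*}
    {φ : A → X → X} {L : A → ℝ≥0} (hlip : ∀ i, LipschitzWith (L i) (φ i)) {K : Set X}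
    (hattr : K ⊆ ⋃ i, φ i '' K) (hsum : ∑' i, (L i : ℝ≥0∞) ≤ 1) {c : ℝ≥0} (hc : ∀ i, L i ≤ c)
    (n : ℕ) : ∃ t : (Fin n → A) → Set X, K ⊆ ⋃ w, t w ∧
      (∀ w, Metric.ediam (t w) ≤ (c : ℝ≥0∞) ^ n * Metric.ediam K) ∧
      ∑' w, Metric.ediam (t w) ≤ Metric.ediam K := by
  induction n with
  | zero => exact ⟨fun _ => K, (iUnion_const K).superset, by simp, by simp⟩
  | succ n ih =>
    obtain ⟨t, hcov, hdiam, htsum⟩ := ih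
    have hstep : ∀ i w, Metric.ediam (φ i '' t w) ≤ L i * Metric.ediam (t w) :=
      fun i w => (hlip i).ediam_image_le _
    refine ⟨fun w => φ (w 0) '' t (Fin.tail w), fun p hp => ?_, fun w => ?_, ?_⟩
    · obtain ⟨i, q, hq, rfl⟩ := mem_iUnion.1 (hattr hp)
      obtain ⟨w, hw⟩ := mem_iUnion.1 (hcov hq)
      exact mem_iUnion.2 ⟨Fin.cons i w, by simpa using mem_image_of_mem (φ i) hw⟩
    · calc _ ≤ (L (w 0) : ℝ≥0∞) * Metric.ediam (t (Fin.tail w)) := hstep _ _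
        _ ≤ c * ((c : ℝ≥0∞) ^ n * Metric.ediam K) :=
            mul_le_mul' (by exact_mod_cast hc _) (hdiam _)
        _ = _ := by rw [pow_succ']; ring
    · calc ∑' w : Fin (n + 1) → A, Metric.ediam (φ (w 0) '' t (Fin.tail w))
          = ∑' z : A × (Fin n → A), Metric.ediam (φ z.1 '' t z.2) := by
            rw [← (Fin.consEquiv fun _ : Fin (n + 1) => A).tsum_eq]
            simp [Fin.consEquiv]
        _ ≤ ∑' z : A × (Fin n → A), (L z.1 : ℝ≥0∞) * Metric.ediam (t z.2) :=
            ENNReal.tsum_le_tsum fun z => hstep z.1 z.2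
        _ = (∑' i, (L i : ℝ≥0∞)) * ∑' w, Metric.ediam (t w) := by
            rw [ENNReal.tsum_prod (f := fun i w => (L i : ℝ≥0∞) * Metric.ediam (t w))]
            simp_rw [ENNReal.tsum_mul_left, ENNReal.tsum_mul_right]
        _ ≤ 1 * Metric.ediam K := mul_le_mul' hsum htsum
        _ = Metric.ediam K := one_mul _

/-- A bounded self-similar set with contraction ratios of sum at most `1` has length at most its
diameter. -/
theorem hausdorffMeasure_le_ediam_of_subset_iUnion_image {X : Type*} [MetricSpace X]
    [MeasurableSpace X] [BorelSpace X] {A : Type*} [Countable A] {φ : A → X → X} {L : A → ℝ≥0}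
    (hL : ∀ i, L i < 1) (hlip : ∀ i, LipschitzWith (L i) (φ i)) {K : Set X}
    (hK : Bornology.IsBounded K) (hattr : K ⊆ ⋃ i, φ i '' K)
    (hsum : ∑' i, (L i : ℝ≥0∞) ≤ 1) : μH[1] K ≤ Metric.ediam K := by
  obtain ⟨c, hc, hLc⟩ := exists_lt_one_forall_le_of_tsum_le_one hL hsum
  choose t hcov hdiam htsum using exists_cover_of_subset_iUnion_image hlip hattr hsum hLc
  have hlim : Tendsto (fun n : ℕ => (c : ℝ≥0∞) ^ n * Metric.ediam K) atTop (𝓝 0) := by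
    simpa using ENNReal.Tendsto.mul_const
      (ENNReal.tendsto_pow_atTop_nhds_zero_of_lt_one (by exact_mod_cast hc))
      (Or.inr hK.ediam_ne_top)
  refine (hausdorffMeasure_le_liminf_tsum 1 K _ hlim t (.of_forall hdiam)
    (.of_forall hcov)).trans ?_
  simp only [ENNReal.rpow_one]
  exact (liminf_le_liminf (.of_forall htsum)).trans_eq (liminf_const _)

/-- If the attractor `K` of a countable IFS of contractions on a compact metric
space is a nonempty compact connected set and `∑ᵢ Lip(φᵢ) ≤ 1` (i.e. `sdim F = 1`),
then `K` is isometric to a (possibly degenerate) closed line segment. -/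
theorem stmt4 {X : Type*} [MetricSpace X] [CompactSpace X]
    {A : Type*} [Countable A] (φ : A → X → X) (L : A → ℝ≥0)
    (hL : ∀ i, 0 < L i ∧ L i < 1) (hlip : ∀ i, LipschitzWith (L i) (φ i))
    (K : Set X) (hK : IsCompact K) (hne : K.Nonempty) (hconn : IsConnected K)
    (hattr : K = ⋃ i, φ i '' K)
    (hsum : (∑' i, (L i : ℝ≥0∞)) ≤ 1) :
    ∃ d : ℝ, 0 ≤ d ∧ Nonempty (↥K ≃ᵢ ↥(Set.Icc (0:ℝ) d)) := by
  borelize X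
  exact exists_isometryEquiv_Icc_of_hausdorffMeasure_le hK hconn
    (hausdorffMeasure_le_ediam_of_subset_iUnion_image (fun i => (hL i).2) hlip hK.isBounded
      hattr.subset hsum)
end

section
/- Let X be a metric space, K ⊆ X, s ≥ 1, H > 0, and suppose f : [0,1] → K is a surjection satisfying |f(x) − f(y)|^s ≤ H|x − y| for all x,y. Suppose (p_n), (q_n) are sequences of points in K and (I_n) a sequence of pairwise disjoint (in interiors) subintervals of [0,1] with {p_n, q_n} ⊆ f(I_n) for all n. Then ∑_{n=1}^∞ d(p_n, q_n)^s ≤ H. -/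
/-- Finitely many subintervals of `[0,1]` with pairwise disjoint interiors have total length at
most `1`. -/
theorem sum_length_le_one_of_disjoint_Ioo {ι : Type*} (t : Finset ι) (c d : ι → ℝ)
    (hcd : ∀ i, c i ≤ d i) (hsub : ∀ i, Set.Icc (c i) (d i) ⊆ Set.Icc (0 : ℝ) 1)
    (hdisj : Pairwise fun i j => Disjoint (Set.Ioo (c i) (d i)) (Set.Ioo (c j) (d j))) :
    ∑ i ∈ t, (d i - c i) ≤ 1 := by
  have hunion : (⋃ i ∈ t, Set.Ioo (c i) (d i)) ⊆ Set.Icc (0 : ℝ) 1 :=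
    Set.iUnion₂_subset fun i _ => Set.Ioo_subset_Icc_self.trans (hsub i)
  have hle := MeasureTheory.measure_mono (μ := MeasureTheory.volume) hunion
  rw [MeasureTheory.measure_biUnion_finset (fun i _ j _ hij => hdisj hij)
    fun i _ => measurableSet_Ioo] at hle
  simp only [Real.volume_Ioo, Real.volume_Icc, sub_zero] at hle
  rw [← ENNReal.ofReal_sum_of_nonneg fun i _ => sub_nonneg.2 (hcd i)] at hle
  exact (ENNReal.ofReal_le_ofReal_iff zero_le_one).1 hle

/-- If `f : [0,1] → K` satisfies `d(f x, f y)^s ≤ H|x - y|` and is onto `K`,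
and intervals `[cₙ, dₙ] ⊆ [0,1]` with pairwise disjoint interiors satisfy
`{pₙ, qₙ} ⊆ f([cₙ, dₙ])`, then `∑ d(pₙ, qₙ)^s ≤ H`. -/
theorem stmt18 {X : Type*} [MetricSpace X] (K : Set X) (s H : ℝ)
    (hs : 1 ≤ s) (hH : 0 < H)
    (f : ℝ → X) (hsurj : f '' Set.Icc 0 1 = K)
    (hhold : ∀ x ∈ Set.Icc (0:ℝ) 1, ∀ y ∈ Set.Icc (0:ℝ) 1,
      dist (f x) (f y) ^ s ≤ H * |x - y|)
    (p q : ℕ → X) (c d : ℕ → ℝ)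
    (hcd : ∀ n, c n ≤ d n)
    (hsub : ∀ n, Set.Icc (c n) (d n) ⊆ Set.Icc (0:ℝ) 1)
    (hdisj : ∀ m n, m ≠ n →
      Set.Ioo (c m) (d m) ∩ Set.Ioo (c n) (d n) = ∅)
    (hmem : ∀ n, p n ∈ f '' Set.Icc (c n) (d n) ∧
      q n ∈ f '' Set.Icc (c n) (d n)) :
    ∑' n, dist (p n) (q n) ^ s ≤ H := by
  have hterm : ∀ n, dist (p n) (q n) ^ s ≤ H * (d n - c n) := by
    intro n
    obtain ⟨⟨x, hx, hxp⟩, ⟨y, hy, hyq⟩⟩ := hmem n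
    rw [← hxp, ← hyq]
    refine (hhold x (hsub n hx) y (hsub n hy)).trans ?_
    gcongr
    exact abs_sub_le_iff.2 ⟨by linarith [hx.2, hy.1], by linarith [hx.1, hy.2]⟩
  refine Real.tsum_le_of_sum_range_le (fun n => Real.rpow_nonneg dist_nonneg s) fun N => ?_
  calc ∑ n ∈ Finset.range N, dist (p n) (q n) ^ s
      ≤ ∑ n ∈ Finset.range N, H * (d n - c n) := Finset.sum_le_sum fun n _ => hterm n
    _ = H * ∑ n ∈ Finset.range N, (d n - c n) := (Finset.mul_sum ..).symm
    _ ≤ H * 1 := by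
        gcongr
        exact sum_length_le_one_of_disjoint_Ioo _ c d hcd hsub fun m n hmn =>
          Set.disjoint_iff_inter_eq_empty.2 (hdisj m n hmn)
    _ = H := mul_one H
end
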